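/- arXiv:1108.1855 — 10 statements merged into one kernel-verified Lean document; each statement's English description precedes it below -/
import Mathlib

section
/- If vertex 0 is a globally reachable vertex of the digraph G (i.e., from every vertex i ∈ {1,...,n} there is a directed path of arcs from i to 0), then the matrix H = L + B is positive stable, i.e., every eigenvalue of H over ℂ has strictly positive real part. -/
/-- If `w` has maximal modulus at `i` and a nonnegatively weighted sum of the differences
`w i - w k` equals `μ * w i` with `μ.re ≤ 0`, then `w` also has maximal modulus at every `k`
of positive weight. -/
theorem norm_eq_of_sum_mul_sub_eq_mul {V : Type*} [Fintype V] {c : V → ℝ} (hc : ∀ k, 0 ≤ c k)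
    {w : V → ℂ} {i : V} (hmax : ∀ k, ‖w k‖ ≤ ‖w i‖) {μ : ℂ} (hμ : μ.re ≤ 0)
    (heq : ∑ k, (c k : ℂ) * (w i - w k) = μ * w i) {k : V} (hk : 0 < c k) :
    ‖w k‖ = ‖w i‖ := by
  have hinner : ∀ k, (w k * star (w i)).re ≤ ‖w k‖ * ‖w i‖ := fun k => by
    simpa using Complex.re_le_norm (w k * star (w i))
  have hself : w i * star (w i) = ((‖w i‖ ^ 2 : ℝ) : ℂ) := by
    simpa using Complex.mul_conj' (w i)
  have hterm : ∀ k, 0 ≤ c k * (‖w i‖ ^ 2 - (w k * star (w i)).re) := fun k =>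
    mul_nonneg (hc k) (by nlinarith [hinner k, hmax k, norm_nonneg (w i)])
  have hsum : ∑ k, c k * (‖w i‖ ^ 2 - (w k * star (w i)).re) = μ.re * ‖w i‖ ^ 2 := by
    have h := congrArg (fun z : ℂ => (z * star (w i)).re) heq
    simp only [Finset.sum_mul, mul_assoc, sub_mul, hself, Complex.re_sum, Complex.re_ofReal_mul,
      Complex.sub_re, Complex.ofReal_re, Complex.re_mul_ofReal] at h
    exact h
  have hle : c k * (‖w i‖ ^ 2 - (w k * star (w i)).re) ≤ 0 :=
    (Finset.single_le_sum (fun k _ => hterm k) (Finset.mem_univ k)).trans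
      (hsum.trans_le (mul_nonpos_of_nonpos_of_nonneg hμ (sq_nonneg _)))
  have hre : ‖w i‖ ^ 2 ≤ (w k * star (w i)).re := by
    by_contra! h
    exact absurd hle (not_le.2 (mul_pos hk (sub_pos.2 h)))
  refine le_antisymm (hmax k) ?_
  by_contra! h
  nlinarith [hinner k, norm_nonneg (w k)]

/-- If vertex 0 is globally reachable in the digraph `G` given by the
0/1 adjacency function `a` on `{0,1,...,n}` (every vertex has a directed path of arcs
to vertex 0), then the matrix `H = L + B`, with `H i i = ∑_{k=0}^n a(i,k)` and
`H i j = -a(i,j)` for `i ≠ j` (indices running over the followers `{1,...,n}`),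
is positive stable: every eigenvalue of `H` over `ℂ` has strictly positive real part. -/
theorem stmt0 (n : ℕ) (hn : 0 < n) (a : Fin (n + 1) → Fin (n + 1) → ℝ)
    (ha01 : ∀ i j, a i j = 0 ∨ a i j = 1) (haii : ∀ i, a i i = 0)
    (hreach : ∀ i : Fin (n + 1),
      Relation.ReflTransGen (fun u v : Fin (n + 1) => a u v = 1) i 0) :
    ∀ μ ∈ spectrum ℂ
      ((Matrix.of fun i j : Fin n =>
          if i = j then ∑ k : Fin (n + 1), a i.succ k else -(a i.succ j.succ)).map
        (algebraMap ℝ ℂ)),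
      0 < μ.re := by
  intro μ hmem
  by_contra! hμ
  rw [← Matrix.spectrum_toLin', ← Module.End.hasEigenvalue_iff_mem_spectrum] at hmem
  obtain ⟨v, hv⟩ := hmem.exists_hasEigenvector
  have hHv := hv.apply_eq_smul
  rw [Matrix.toLin'_apply] at hHv
  set w : Fin (n + 1) → ℂ := Fin.cons 0 v with hw
  have heq : ∀ i : Fin n,
      ∑ k, (a i.succ k : ℂ) * (w i.succ - w k) = μ * w i.succ := by
    intro i
    have hi := congrFun hHv i
    simp only [Matrix.mulVec, dotProduct, Matrix.map_apply, Matrix.of_apply, Pi.smul_apply,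
      smul_eq_mul] at hi
    rw [hw, Fin.cons_succ, ← hi]
    have hentry : ∀ j : Fin n, algebraMap ℝ ℂ
        (if i = j then ∑ k, a i.succ k else -(a i.succ j.succ)) * v j =
        (if i = j then (∑ k, (a i.succ k : ℂ)) * v j else 0) - a i.succ j.succ * v j := by
      intro j
      split_ifs with hij
      · subst hij
        simp [haii]
      · simp
    simp only [hentry, Finset.sum_sub_distrib, Finset.sum_ite_eq, Finset.mem_univ, if_true,
      mul_sub, ← Finset.sum_mul]
    congr 1
    simp [Fin.sum_univ_succ]
  obtain ⟨m, hm⟩ := Finite.exists_max fun k => ‖w k‖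
  have hpath : ∀ k, Relation.ReflTransGen (fun u v : Fin (n + 1) => a u v = 1) k 0 →
      ‖w k‖ = ‖w m‖ → ‖w 0‖ = ‖w m‖ := by
    intro k hk
    induction hk using Relation.ReflTransGen.head_induction_on with
    | refl => exact id
    | @head u x hux _ ih =>
      intro hu
      cases u using Fin.cases with
      | zero => exact hu
      | succ i =>
        refine ih ((norm_eq_of_sum_mul_sub_eq_mul (c := a i.succ) (fun k => ?_)
          (fun k => (hm k).trans_eq hu.symm) hμ (heq i) (by simp [hux])).trans hu)
        rcases ha01 i.succ k with h | h <;> simp [h]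
  have hzero : ‖w m‖ = 0 := by
    rw [← hpath m (hreach m) rfl]
    simp [hw]
  refine hv.2 (funext fun i => ?_)
  simpa [hw] using (hm i.succ).trans_eq hzero
end

section
/- If the matrix H = L + B is positive stable (every eigenvalue of H over ℂ has strictly positive real part), then vertex 0 is a globally reachable vertex of the digraph G, i.e., from every vertex i ∈ {1,...,n} there is a directed path of arcs from i to 0. -/
/-- A square matrix is singular if some nonempty set of rows is supported on the corresponding
columns and has vanishing row sums. -/
theorem Matrix.det_eq_zero_of_rows_sum_eq_zero {ι R : Type*} [Fintype ι] [DecidableEq ι]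
    [CommRing R] [IsDomain R] (M : Matrix ι ι R) (p : ι → Prop)
    (hblock : ∀ i, ¬p i → ∀ j, p j → M i j = 0) (hsum : ∀ i, ¬p i → ∑ j, M i j = 0)
    (hne : ∃ i, ¬p i) : M.det = 0 := by
  classical
  obtain ⟨i₀, hi₀⟩ := hne
  rw [Matrix.twoBlockTriangular_det M p hblock]
  refine mul_eq_zero_of_right _ (Matrix.exists_mulVec_eq_zero_iff.mp ⟨fun _ => 1, ?_, ?_⟩)
  · exact fun h => one_ne_zero (congrFun h ⟨i₀, hi₀⟩)
  · ext i
    have hcompl : ∑ j : {j // p j}, M i j = 0 :=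
      Finset.sum_eq_zero fun j _ => hblock i i.2 j j.2
    have hsplit := Fintype.sum_subtype_add_sum_subtype p fun j => M i j
    rw [hcompl, zero_add, hsum i i.2] at hsplit
    simpa [Matrix.mulVec, dotProduct, Matrix.toSquareBlockProp_def] using hsplit

/-- The row sums of `L + B` are the entries of the leader adjacency matrix `B`. -/
theorem sum_row_laplacian_add_leader {n : ℕ} (a : Fin (n + 1) → Fin (n + 1) → ℝ)
    (haii : ∀ i, a i i = 0) (i : Fin n) :
    ∑ j : Fin n, (if i = j then ∑ k : Fin (n + 1), a i.succ k else -(a i.succ j.succ)) =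
      a i.succ 0 := by
  have hentry : ∀ j : Fin n,
      (if i = j then ∑ k : Fin (n + 1), a i.succ k else -(a i.succ j.succ)) =
        (if i = j then ∑ k : Fin (n + 1), a i.succ k else 0) - a i.succ j.succ := by
    intro j
    split_ifs with h
    · simp [← h, haii]
    · simp
  simp_rw [hentry, Finset.sum_sub_distrib]
  simp [Fin.sum_univ_succ]

/-- If the matrix `H = L + B`, with `H i i = ∑_{k=0}^n a(i,k)` and
`H i j = -a(i,j)` for `i ≠ j` (indices running over the followers `{1,...,n}`),
is positive stable (every eigenvalue of `H` over `ℂ` has strictly positive real part),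
then vertex 0 is globally reachable in the digraph `G` given by the 0/1 adjacency
function `a` on `{0,1,...,n}`: every vertex has a directed path of arcs to vertex 0. -/
theorem stmt1 (n : ℕ) (hn : 0 < n) (a : Fin (n + 1) → Fin (n + 1) → ℝ)
    (ha01 : ∀ i j, a i j = 0 ∨ a i j = 1) (haii : ∀ i, a i i = 0)
    (hstable : ∀ μ ∈ spectrum ℂ
      ((Matrix.of fun i j : Fin n =>
          if i = j then ∑ k : Fin (n + 1), a i.succ k else -(a i.succ j.succ)).map
        (algebraMap ℝ ℂ)),
      0 < μ.re) :
    ∀ i : Fin (n + 1),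
      Relation.ReflTransGen (fun u v : Fin (n + 1) => a u v = 1) i 0 := by
  by_contra! hunreach
  obtain ⟨i₀, hi₀⟩ := hunreach
  set reach : Fin (n + 1) → Prop :=
    fun i => Relation.ReflTransGen (fun u v : Fin (n + 1) => a u v = 1) i 0
  have harc : ∀ i, ¬reach i → ∀ j, reach j → a i j = 0 := fun i hi j hj =>
    (ha01 i j).resolve_right fun h => hi (Relation.ReflTransGen.head h hj)
  have hdet := Matrix.det_eq_zero_of_rows_sum_eq_zero
    (Matrix.of fun i j : Fin n =>
      if i = j then ∑ k : Fin (n + 1), a i.succ k else -(a i.succ j.succ))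
    (fun i => reach i.succ)
    (fun i hi j hj => by
      have hij : i ≠ j := fun h => hi (h ▸ hj)
      simp [hij, harc _ hi _ hj])
    (fun i hi => (sum_row_laplacian_add_leader a haii i).trans
      (harc _ hi 0 Relation.ReflTransGen.refl))
    (by
      have hne : i₀ ≠ 0 := fun h => hi₀ (h ▸ Relation.ReflTransGen.refl)
      exact ⟨i₀.pred hne, by simpa [reach] using hi₀⟩)
  refine lt_irrefl (0 : ℝ) (hstable 0 ?_)
  rw [spectrum.zero_mem_iff, Matrix.isUnit_iff_isUnit_det, ← RingHom.mapMatrix_apply,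
    ← RingHom.map_det, hdet]
  simp
end

section
/- Suppose vertex 0 is a globally reachable vertex of the digraph G and the follower subgraph G^f is balanced, i.e., Σ_{j=1}^{n} a(i,j) = Σ_{j=1}^{n} a(j,i) for every i ∈ {1,...,n}. Then H + Hᵀ is a symmetric positive definite matrix, where H = L + B. -/
open Matrix

/-- For a balanced weight `w`, the quadratic form of its Laplacian is half the weighted sum of
squared differences. -/
lemma two_mul_sum_balanced_eq_sum_sq {ι : Type*} [Fintype ι] (w : ι → ι → ℝ)
    (hw : ∀ i, ∑ j, w i j = ∑ j, w j i) (x : ι → ℝ) :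
    2 * ∑ i, x i * ∑ j, w i j * (x i - x j) = ∑ i, ∑ j, w i j * (x i - x j) ^ 2 := by
  have hswap : ∑ i, ∑ j, w i j * x i ^ 2 = ∑ i, ∑ j, w i j * x j ^ 2 := by
    rw [Finset.sum_comm (f := fun i j => w i j * x j ^ 2)]
    simp only [← Finset.sum_mul, hw]
  rw [← sub_eq_zero, ← Finset.sum_sub_distrib] at hswap
  rw [← sub_eq_zero, ← hswap, Finset.mul_sum, ← Finset.sum_sub_distrib]
  refine Finset.sum_congr rfl fun i _ => ?_
  simp only [Finset.mul_sum, ← Finset.sum_sub_distrib]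
  exact Finset.sum_congr rfl fun j _ => by ring

/-- The action of `H = L + B`, written with edge differences. -/
lemma leaderLaplacian_mulVec {n : ℕ} (a : Fin (n + 1) → Fin (n + 1) → ℝ)
    (haii : ∀ i, a i i = 0) (x : Fin n → ℝ) (i : Fin n) :
    ((Matrix.of fun i j : Fin n =>
        if i = j then ∑ k : Fin (n + 1), a i.succ k else -(a i.succ j.succ)) *ᵥ x) i =
      a i.succ 0 * x i + ∑ j : Fin n, a i.succ j.succ * (x i - x j) := by
  have hentry (j : Fin n) :
      (if i = j then ∑ k : Fin (n + 1), a i.succ k else -(a i.succ j.succ)) * x j =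
        (if i = j then (∑ k : Fin (n + 1), a i.succ k) * x j else 0) -
          a i.succ j.succ * x j := by
    split_ifs with h
    · subst h
      simp [haii]
    · ring
  simp only [Matrix.mulVec, dotProduct, Matrix.of_apply, hentry, Finset.sum_sub_distrib,
    Finset.sum_ite_eq, Finset.mem_univ, if_true, mul_sub, ← Finset.sum_mul]
  rw [Fin.sum_univ_succ]
  ring

/-- If vertex 0 is globally reachable in the digraph `G` given by the
0/1 adjacency function `a` on `{0,1,...,n}` and the follower subgraph `G^f` on
`{1,...,n}` is balanced (`∑_{j=1}^n a(i,j) = ∑_{j=1}^n a(j,i)` for every follower `i`),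
then `H + Hᵀ` is a symmetric positive definite matrix, where `H = L + B` is given by
`H i i = ∑_{k=0}^n a(i,k)` and `H i j = -a(i,j)` for `i ≠ j`. -/
theorem stmt2 (n : ℕ) (hn : 0 < n) (a : Fin (n + 1) → Fin (n + 1) → ℝ)
    (ha01 : ∀ i j, a i j = 0 ∨ a i j = 1) (haii : ∀ i, a i i = 0)
    (hreach : ∀ i : Fin (n + 1),
      Relation.ReflTransGen (fun u v : Fin (n + 1) => a u v = 1) i 0)
    (hbalanced : ∀ i : Fin n,
      ∑ j : Fin n, a i.succ j.succ = ∑ j : Fin n, a j.succ i.succ) :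
    ((Matrix.of fun i j : Fin n =>
        if i = j then ∑ k : Fin (n + 1), a i.succ k else -(a i.succ j.succ)) +
      (Matrix.of fun i j : Fin n =>
        if i = j then ∑ k : Fin (n + 1), a i.succ k else -(a i.succ j.succ))ᵀ).PosDef := by
  rw [Matrix.posDef_iff_dotProduct_mulVec]
  refine ⟨by simpa using Matrix.isHermitian_add_transpose_self (Matrix.of fun i j : Fin n =>
    if i = j then ∑ k : Fin (n + 1), a i.succ k else -(a i.succ j.succ)), fun x hx => ?_⟩
  have ha (i j) : 0 ≤ a i j := by rcases ha01 i j with h | h <;> simp [h]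
  have hform : star x ⬝ᵥ (((Matrix.of fun i j : Fin n =>
        if i = j then ∑ k : Fin (n + 1), a i.succ k else -(a i.succ j.succ)) +
      (Matrix.of fun i j : Fin n =>
        if i = j then ∑ k : Fin (n + 1), a i.succ k else -(a i.succ j.succ))ᵀ) *ᵥ x) =
      2 * ∑ i : Fin n, a i.succ 0 * x i ^ 2 +
        ∑ i : Fin n, ∑ j : Fin n, a i.succ j.succ * (x i - x j) ^ 2 := by
    rw [← two_mul_sum_balanced_eq_sum_sq (fun i j => a i.succ j.succ) hbalanced x, star_trivial,
      Matrix.add_mulVec, dotProduct_add, Matrix.mulVec_transpose,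
      dotProduct_comm x (x ᵥ* _), ← Matrix.dotProduct_mulVec, ← two_mul, ← mul_add]
    simp only [dotProduct, leaderLaplacian_mulVec a haii]
    rw [← Finset.sum_add_distrib]
    congr 1
    exact Finset.sum_congr rfl fun i _ => by ring
  rw [hform]
  have hB (i : Fin n) : 0 ≤ a i.succ 0 * x i ^ 2 := mul_nonneg (ha _ _) (sq_nonneg _)
  have hL (i j : Fin n) : 0 ≤ a i.succ j.succ * (x i - x j) ^ 2 :=
    mul_nonneg (ha _ _) (sq_nonneg _)
  have hBsum := Finset.sum_nonneg fun i (_ : i ∈ Finset.univ) => hB i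
  have hLrow (i : Fin n) := Finset.sum_nonneg fun j (_ : j ∈ Finset.univ) => hL i j
  have hLsum := Finset.sum_nonneg fun i (_ : i ∈ Finset.univ) => hLrow i
  by_contra! hle
  have hB0 (i : Fin n) : a i.succ 0 * x i ^ 2 = 0 :=
    (Finset.sum_eq_zero_iff_of_nonneg fun i _ => hB i).1 (by linarith) i (Finset.mem_univ i)
  have hL0 (i j : Fin n) : a i.succ j.succ * (x i - x j) ^ 2 = 0 :=
    (Finset.sum_eq_zero_iff_of_nonneg fun j _ => hL i j).1
      ((Finset.sum_eq_zero_iff_of_nonneg fun i _ => hLrow i).1 (by linarith) i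
        (Finset.mem_univ i)) j (Finset.mem_univ j)
  -- `x`, extended by `0` at the leader, vanishes backwards along every path to the leader.
  have hzero (u : Fin (n + 1)) : (Fin.cons 0 x : Fin (n + 1) → ℝ) u = 0 := by
    induction hreach u using Relation.ReflTransGen.head_induction_on with
    | refl => rfl
    | @head u v huv _ ih =>
      induction u using Fin.cases with
      | zero => rfl
      | succ i =>
        induction v using Fin.cases with
        | zero => simpa [huv] using hB0 i
        | succ j =>
          have hj : x j = 0 := by simpa using ih
          simpa [huv, hj] using hL0 i j
  exact hx (funext fun i => by simpa using hzero i.succ)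
end

section
/- Let H ∈ ℝ^{n×n} be positive stable, i.e., every eigenvalue of H over ℂ has strictly positive real part. Then there exists a symmetric positive definite matrix P̄ ∈ ℝ^{n×n} satisfying the Lyapunov equation Hᵀ P̄ + P̄ H = I_n. -/
open Matrix

open Filter Topology
open scoped NNReal ENNReal Matrix.Norms.L2Operator

/-- In a complex Banach algebra, the powers of an element whose spectrum lies in the open unit disc
decay geometrically. -/
theorem exists_eventually_norm_pow_le_pow {A : Type*} [NormedRing A] [NormedAlgebra ℂ A]
    [CompleteSpace A] [Nontrivial A] (a : A) (ha : ∀ z ∈ spectrum ℂ a, ‖z‖ < 1) :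
    ∃ q : ℝ, 0 ≤ q ∧ q < 1 ∧ ∀ᶠ k : ℕ in atTop, ‖a ^ k‖ ≤ q ^ k := by
  have hr : spectralRadius ℂ a < (1 : ℝ≥0) := spectrum.spectralRadius_lt_of_forall_lt a ha
  obtain ⟨q, hq, hq1⟩ := ENNReal.lt_iff_exists_nnreal_btwn.mp hr
  refine ⟨q, q.2, by exact_mod_cast hq1, ?_⟩
  filter_upwards [(spectrum.pow_nnnorm_pow_one_div_tendsto_nhds_spectralRadius a).eventually_lt_const
    hq, eventually_ne_atTop 0] with k hk hk0
  have h := ENNReal.rpow_le_rpow hk.le (Nat.cast_nonneg (α := ℝ) k)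
  rw [← ENNReal.rpow_mul, one_div_mul_cancel (Nat.cast_ne_zero.mpr hk0), ENNReal.rpow_one,
    ENNReal.rpow_natCast] at h
  exact_mod_cast h

namespace Matrix

variable {m : Type*} [Fintype m]

theorem PosSemidef.of_hasSum {f : ℕ → Matrix m m ℝ} {P : Matrix m m ℝ}
    (hf : ∀ k, (f k).PosSemidef) (h : HasSum f P) : P.PosSemidef := by
  refine .of_dotProduct_mulVec_nonneg ?_ fun x ↦ ?_
  · exact h.matrix_conjTranspose.unique (by simpa only [(hf _).isHermitian.eq] using h)
  · let φ : Matrix m m ℝ →+ ℝ :=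
      { toFun := fun M ↦ star x ⬝ᵥ (M *ᵥ x)
        map_zero' := by simp
        map_add' := fun M N ↦ by rw [add_mulVec, dotProduct_add] }
    have hφ : Continuous φ :=
      continuous_const.dotProduct (continuous_id.matrix_mulVec continuous_const)
    exact (h.map φ hφ).nonneg fun k ↦ (hf k).dotProduct_mulVec_nonneg x

variable [DecidableEq m]

theorem summable_conjTranspose_pow_mul_mul_pow [Nonempty m] (C Q : Matrix m m ℂ)
    (hC : ∀ z ∈ spectrum ℂ C, ‖z‖ < 1) :
    Summable fun k : ℕ ↦ (C ^ k)ᴴ * Q * C ^ k := by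
  obtain ⟨q, hq0, hq1, hq⟩ := exists_eventually_norm_pow_le_pow C hC
  refine Summable.of_norm_bounded_eventually_nat (g := fun k ↦ ‖Q‖ * (q ^ 2) ^ k)
    ((summable_geometric_of_lt_one (by positivity) (by nlinarith)).mul_left _) ?_
  filter_upwards [hq] with k hk
  calc ‖(C ^ k)ᴴ * Q * C ^ k‖ ≤ ‖(C ^ k)ᴴ‖ * ‖Q‖ * ‖C ^ k‖ := norm_mul₃_le
    _ = ‖C ^ k‖ * ‖Q‖ * ‖C ^ k‖ := by rw [l2_opNorm_conjTranspose]
    _ ≤ q ^ k * ‖Q‖ * q ^ k := by gcongr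
    _ = ‖Q‖ * (q ^ 2) ^ k := by ring

/-- Solvability of the Stein (discrete Lyapunov) equation. -/
theorem exists_posDef_sub_transpose_mul_mul_eq (C Q : Matrix m m ℝ)
    (hC : ∀ z ∈ spectrum ℂ (C.map (algebraMap ℝ ℂ)), ‖z‖ < 1) (hQ : Q.PosDef) :
    ∃ P : Matrix m m ℝ, P.PosDef ∧ P - Cᵀ * P * C = Q := by
  cases isEmpty_or_nonempty m
  · exact ⟨Q, hQ, Subsingleton.elim _ _⟩
  let f : ℕ → Matrix m m ℝ := fun k ↦ (C ^ k)ᵀ * Q * C ^ k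
  have hf : Summable f := by
    have h := (summable_conjTranspose_pow_mul_mul_pow _ (Q.map (algebraMap ℝ ℂ)) hC).map
      (Complex.reAddGroupHom.mapMatrix (m := m) (n := m))
      (continuous_id.matrix_map Complex.continuous_re)
    convert h using 1
    ext1 k
    have hk : ((C.map (algebraMap ℝ ℂ)) ^ k)ᴴ * Q.map (algebraMap ℝ ℂ) *
        (C.map (algebraMap ℝ ℂ)) ^ k = (f k).map (algebraMap ℝ ℂ) := by
      have hstar : ((C ^ k).map (algebraMap ℝ ℂ))ᴴ = (C ^ k)ᵀ.map (algebraMap ℝ ℂ) := by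
        ext i j
        simp [-transpose_pow]
      simp only [f, Matrix.map_mul, ← hstar, Matrix.map_pow]
    simp only [Function.comp_apply, hk]
    ext i j
    simp
  obtain ⟨P, hP⟩ := hf
  have hPC : P - Cᵀ * P * C = Q := by
    have hstep : HasSum (fun k ↦ f (k + 1)) (Cᵀ * P * C) := by
      have hf_succ : ∀ k, f (k + 1) = Cᵀ * f k * C := fun k ↦ by
        simp only [f, pow_succ, transpose_mul, Matrix.mul_assoc]
      simp only [hf_succ]
      exact (hP.mul_left Cᵀ).mul_right C
    have h0 : f 0 = Q := by simp [f]
    rw [((hasSum_nat_add_iff' 1).mpr hP).unique hstep |>.symm]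
    simp [h0]
  refine ⟨P, ?_, hPC⟩
  have hpos : P.PosSemidef := .of_hasSum
    (fun k ↦ by simpa [f] using hQ.posSemidef.conjTranspose_mul_mul_same (C ^ k)) hP
  rw [sub_eq_iff_eq_add.mp hPC]
  exact hQ.add_posSemidef (by simpa using hpos.conjTranspose_mul_mul_same C)

/-- The Cayley transform sends the open right half-plane into the open unit disc. -/
theorem norm_lt_one_of_mem_spectrum_cayley (H : Matrix m m ℂ)
    (hH : ∀ μ ∈ spectrum ℂ H, 0 < μ.re) (hu : IsUnit (1 + H)) {z : ℂ}
    (hz : z ∈ spectrum ℂ ((1 - H) * (1 + H)⁻¹)) : ‖z‖ < 1 := by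
  have hdet : IsUnit (1 + H).det := (isUnit_iff_isUnit_det _).mp hu
  have hnot : ¬ IsUnit (algebraMap ℂ (Matrix m m ℂ) (z - 1) + (1 + z) • H) := by
    intro h
    refine hz ?_
    have heq : algebraMap ℂ (Matrix m m ℂ) z - (1 - H) * (1 + H)⁻¹ =
        (algebraMap ℂ (Matrix m m ℂ) (z - 1) + (1 + z) • H) * (1 + H)⁻¹ := by
      have : algebraMap ℂ (Matrix m m ℂ) z = algebraMap ℂ (Matrix m m ℂ) z * (1 + H) * (1 + H)⁻¹ :=
        (mul_nonsing_inv_cancel_right _ _ hdet).symm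
      rw [this, ← sub_mul]
      congr 1
      simp only [Algebra.algebraMap_eq_smul_one, smul_mul_assoc, one_mul]
      module
    rw [spectrum.mem_resolventSet_iff, heq]
    exact h.mul (isUnit_nonsing_inv_iff.mpr hu)
  have hz1 : 1 + z ≠ 0 := by
    intro h0
    refine hnot ?_
    rw [h0, zero_smul, add_zero]
    refine IsUnit.map _ (IsUnit.mk0 _ fun h1 ↦ ?_)
    have : (2 : ℂ) = 0 := by linear_combination h0 - h1
    norm_num at this
  have hmem : (1 - z) / (1 + z) ∈ spectrum ℂ H := by
    intro h
    refine hnot ?_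
    have heq : algebraMap ℂ (Matrix m m ℂ) (z - 1) + (1 + z) • H =
        algebraMap ℂ (Matrix m m ℂ) (-(1 + z)) *
          (algebraMap ℂ (Matrix m m ℂ) ((1 - z) / (1 + z)) - H) := by
      rw [mul_sub, ← map_mul, show -(1 + z) * ((1 - z) / (1 + z)) = z - 1 by field_simp; ring,
        ← Algebra.smul_def, neg_smul, sub_neg_eq_add]
    rw [heq]
    exact ((IsUnit.mk0 _ (neg_ne_zero.mpr hz1)).map _).mul h
  have hre := hH _ hmem
  have hpos : 0 < Complex.normSq (1 + z) := Complex.normSq_pos.mpr hz1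
  rw [Complex.div_re, ← add_div, div_pos_iff_of_pos_right hpos] at hre
  simp only [Complex.sub_re, Complex.add_re, Complex.one_re, Complex.sub_im, Complex.add_im,
    Complex.one_im] at hre
  have hsq : ‖z‖ ^ 2 < 1 := by
    rw [Complex.sq_norm, Complex.normSq_apply]
    linarith
  exact (sq_lt_one_iff₀ (norm_nonneg z)).mp hsq

end Matrix

/-- If `H ∈ ℝ^{n×n}` is positive stable (every eigenvalue of `H` over `ℂ`
has strictly positive real part), then there exists a symmetric positive definite matrix
`P̄` satisfying the Lyapunov equation `Hᵀ P̄ + P̄ H = I`. -/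
theorem stmt3 (n : ℕ) (H : Matrix (Fin n) (Fin n) ℝ)
    (hstable : ∀ μ ∈ spectrum ℂ (H.map (algebraMap ℝ ℂ)), 0 < μ.re) :
    ∃ P : Matrix (Fin n) (Fin n) ℝ, P.IsSymm ∧ P.PosDef ∧ Hᵀ * P + P * H = 1 := by
  have hnot : (-1 : ℂ) ∉ spectrum ℂ (H.map (algebraMap ℝ ℂ)) := fun h ↦ by
    have := hstable _ h
    norm_num at this
  have huC : IsUnit (1 + H.map (algebraMap ℝ ℂ)) := by
    rw [spectrum.notMem_iff, ← IsUnit.neg_iff] at hnot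
    simpa [add_comm] using hnot
  have hmap : (1 + H).map (algebraMap ℝ ℂ) = 1 + H.map (algebraMap ℝ ℂ) := by
    rw [Matrix.map_add _ (map_add _), Matrix.map_one _ (map_zero _) (map_one _)]
  have hdet : IsUnit (1 + H).det := by
    rw [← hmap, isUnit_iff_isUnit_det, ← RingHom.mapMatrix_apply, ← RingHom.map_det] at huC
    exact (isUnit_map_iff _ _).mp huC
  have hu : IsUnit (1 + H) := (isUnit_iff_isUnit_det _).mpr hdet
  have hinv : (1 + H)⁻¹.map (algebraMap ℝ ℂ) = (1 + H.map (algebraMap ℝ ℂ))⁻¹ := by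
    refine (inv_eq_left_inv ?_).symm
    rw [← hmap, ← Matrix.map_mul, nonsing_inv_mul _ hdet,
      Matrix.map_one _ (map_zero _) (map_one _)]
  have hQ : ((2 : ℝ) • ((1 + H)⁻¹ᵀ * (1 + H)⁻¹)).PosDef := by
    refine PosDef.smul ?_ two_pos
    simpa using PosDef.conjTranspose_mul_self (1 + H)⁻¹
      (mulVec_injective_of_isUnit (isUnit_nonsing_inv_iff.mpr hu))
  obtain ⟨P, hP, hPC⟩ := exists_posDef_sub_transpose_mul_mul_eq ((1 - H) * (1 + H)⁻¹) _
    (fun z hz ↦ by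
      rw [Matrix.map_mul, hinv, Matrix.map_sub _ (map_sub _),
        Matrix.map_one _ (map_zero _) (map_one _)] at hz
      exact norm_lt_one_of_mem_spectrum_cayley _ hstable huC hz) hQ
  refine ⟨P, by simpa using hP.isHermitian, hP, ?_⟩
  have hl : (1 + H)ᵀ * (1 + H)⁻¹ᵀ = 1 := by
    rw [← transpose_mul, nonsing_inv_mul _ hdet, transpose_one]
  have hr : (1 + H)⁻¹ * (1 + H) = 1 := nonsing_inv_mul _ hdet
  have key := congrArg (fun M ↦ (1 + H)ᵀ * M * (1 + H)) hPC
  have hleft : (1 + H)ᵀ * (P - ((1 - H) * (1 + H)⁻¹)ᵀ * P * ((1 - H) * (1 + H)⁻¹)) * (1 + H) =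
      (1 + H)ᵀ * P * (1 + H) - (1 - H)ᵀ * P * (1 - H) := by
    calc _ = (1 + H)ᵀ * P * (1 + H) - ((1 + H)ᵀ * (1 + H)⁻¹ᵀ) * (1 - H)ᵀ * P * (1 - H) *
          ((1 + H)⁻¹ * (1 + H)) := by
          rw [transpose_mul]
          noncomm_ring
      _ = _ := by rw [hl, hr, one_mul, mul_one]
  have hright : (1 + H)ᵀ * ((2 : ℝ) • ((1 + H)⁻¹ᵀ * (1 + H)⁻¹)) * (1 + H) = (2 : ℝ) • 1 := by
    calc _ = (2 : ℝ) • (((1 + H)ᵀ * (1 + H)⁻¹ᵀ) * ((1 + H)⁻¹ * (1 + H))) := by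
          simp only [mul_smul_comm, smul_mul_assoc, Matrix.mul_assoc]
      _ = _ := by rw [hl, hr, one_mul]
  have hexp : (1 + H)ᵀ * P * (1 + H) - (1 - H)ᵀ * P * (1 - H) = (2 : ℝ) • (Hᵀ * P + P * H) := by
    rw [transpose_add, transpose_sub, transpose_one, two_smul]
    noncomm_ring
  refine smul_right_injective _ (two_ne_zero (α := ℝ)) ?_
  exact hexp.symm.trans (hleft.symm.trans (key.trans hright))
end

section
/- Let P̄ ∈ ℝ^{n×n} be symmetric positive definite, let 0 < γ < 1, and let k be a real number with k > λ_max(P̄) / (2γ(1−γ²)). Then the 2n×2n block matrix Q₀ = [[k(1−γ²) I_n, −P̄], [−P̄, 2γ P̄]] is symmetric positive definite. -/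
open Matrix

/-- If all eigenvalues of a real symmetric matrix `A` are below `t`, then `t • 1 - A` is
positive definite. -/
theorem Matrix.IsHermitian.posDef_smul_one_sub {ι : Type*} [Fintype ι] [DecidableEq ι]
    {A : Matrix ι ι ℝ} (hA : A.IsHermitian) {t : ℝ} (ht : ∀ i, hA.eigenvalues i < t) :
    (t • (1 : Matrix ι ι ℝ) - A).PosDef := by
  have h : t • (1 : Matrix ι ι ℝ) - A = Unitary.conjStarAlgAut ℝ _ hA.eigenvectorUnitary
      (diagonal fun i ↦ t - hA.eigenvalues i) := by
    have hd : (diagonal fun i ↦ t - hA.eigenvalues i) =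
        t • (1 : Matrix ι ι ℝ) - diagonal (RCLike.ofReal ∘ hA.eigenvalues) := by
      rw [smul_one_eq_diagonal, diagonal_sub]
      rfl
    rw [hd, map_sub, map_smul, map_one, ← hA.spectral_theorem]
  rw [h, Unitary.conjStarAlgAut_apply, Unitary.isUnit_coe.posDef_star_right_conjugate_iff,
    posDef_diagonal_iff]
  exact fun i ↦ sub_pos.2 (ht i)

/-- A scalar version of the Schur complement criterion for positive definiteness. -/
theorem Matrix.PosDef.fromBlocks_smul_one_neg_smul {ι : Type*} [Fintype ι] [DecidableEq ι]
    {P : Matrix ι ι ℝ} (hP : P.PosDef) {a d : ℝ} (hd : 0 < d)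
    (h : ((d * a) • (1 : Matrix ι ι ℝ) - P).PosDef) :
    (fromBlocks (a • (1 : Matrix ι ι ℝ)) (-P) (-P) (d • P)).PosDef := by
  refine .of_dotProduct_mulVec_pos ?_ fun z hz ↦ ?_
  · exact .fromBlocks (isHermitian_one.smul (IsSelfAdjoint.all a))
      (by rw [conjTranspose_neg, hP.1.eq])
      (hP.1.smul (IsSelfAdjoint.all d))
  obtain ⟨x, y, rfl⟩ : ∃ x y : ι → ℝ, z = Sum.elim x y :=
    ⟨_, _, (Sum.elim_comp_inl_inr z).symm⟩
  have hsymm : y ⬝ᵥ P *ᵥ x = x ⬝ᵥ P *ᵥ y := by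
    rw [dotProduct_mulVec, ← mulVec_transpose, dotProduct_comm,
      show Pᵀ = P by simpa using hP.1.eq]
  have hsq : d * (star (Sum.elim x y) ⬝ᵥ
      fromBlocks (a • (1 : Matrix ι ι ℝ)) (-P) (-P) (d • P) *ᵥ Sum.elim x y) =
      star x ⬝ᵥ ((d * a) • (1 : Matrix ι ι ℝ) - P) *ᵥ x +
        star (d • y - x) ⬝ᵥ P *ᵥ (d • y - x) := by
    simp only [star_trivial, fromBlocks_mulVec, Sum.elim_comp_inl, Sum.elim_comp_inr,
      sumElim_dotProduct_sumElim, sub_mulVec, smul_mulVec, one_mulVec, neg_mulVec, mulVec_sub,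
      mulVec_smul, dotProduct_add, dotProduct_sub, dotProduct_neg, dotProduct_smul,
      sub_dotProduct, smul_dotProduct, smul_eq_mul, hsymm]
    ring
  refine pos_of_mul_pos_right (a := d) ?_ hd.le
  rw [hsq]
  by_cases hx : x = 0
  · have hy : d • y - x ≠ 0 := by
      intro hy
      have : y = 0 := by simpa [hx, hd.ne'] using hy
      exact hz (by simp [hx, this])
    exact add_pos_of_nonneg_of_pos (h.posSemidef.dotProduct_mulVec_nonneg x)
      (hP.dotProduct_mulVec_pos hy)
  · exact add_pos_of_pos_of_nonneg (h.dotProduct_mulVec_pos hx)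
      (hP.posSemidef.dotProduct_mulVec_nonneg _)

/-- For a symmetric positive definite `Pbar ∈ ℝ^{n×n}`, `0 < γ < 1` and
`k > λ_max(Pbar) / (2γ(1−γ²))`, the block matrix
`Q₀ = [[k(1−γ²) Iₙ, −Pbar], [−Pbar, 2γ Pbar]]` is symmetric positive definite. -/
theorem stmt5 (n : ℕ) (hn : 0 < n) (Pbar : Matrix (Fin n) (Fin n) ℝ)
    (hP : Pbar.PosDef) (γ k : ℝ) (hγ0 : 0 < γ) (hγ1 : γ < 1)
    (hk : k > (⨆ i, hP.1.eigenvalues i) / (2 * γ * (1 - γ ^ 2))) :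
    (Matrix.fromBlocks ((k * (1 - γ ^ 2)) • (1 : Matrix (Fin n) (Fin n) ℝ)) (-Pbar)
      (-Pbar) ((2 * γ) • Pbar)).IsSymm ∧
    (Matrix.fromBlocks ((k * (1 - γ ^ 2)) • (1 : Matrix (Fin n) (Fin n) ℝ)) (-Pbar)
      (-Pbar) ((2 * γ) • Pbar)).PosDef := by
  have hc : 0 < 2 * γ * (1 - γ ^ 2) := mul_pos (by linarith) (by nlinarith)
  have hev : ∀ i, hP.1.eigenvalues i < 2 * γ * (k * (1 - γ ^ 2)) := fun i ↦
    calc hP.1.eigenvalues i ≤ ⨆ i, hP.1.eigenvalues i :=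
          le_ciSup (Set.finite_range _).bddAbove i
      _ < k * (2 * γ * (1 - γ ^ 2)) := (div_lt_iff₀ hc).1 hk
      _ = 2 * γ * (k * (1 - γ ^ 2)) := by ring
  have hQ := hP.fromBlocks_smul_one_neg_smul (by linarith : 0 < 2 * γ)
    (hP.1.posDef_smul_one_sub hev)
  exact ⟨by simpa [IsSymm, IsHermitian] using hQ.1, hQ⟩
end

section
/- Let H ∈ ℝ^{n×n} be such that H + Hᵀ is positive definite, set λ̄ = λ_min(H + Hᵀ) > 0, let 0 < γ < 1, and let k be a real number with k > 1 / (2γ(1−γ²)λ̄). Then the 2n×2n block matrix Q₀ = [[k(1−γ²)(H + Hᵀ), −I_n], [−I_n, 2γ I_n]] is symmetric positive definite. -/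
open Matrix

namespace Matrix

variable {ι : Type*} [Fintype ι] [DecidableEq ι] {A : Matrix ι ι ℝ}

/-- The Rayleigh quotient of a Hermitian matrix is bounded below by its smallest eigenvalue. -/
theorem IsHermitian.iInf_eigenvalues_mul_dotProduct_le (hA : A.IsHermitian) (x : ι → ℝ) :
    (⨅ i, hA.eigenvalues i) * (x ⬝ᵥ x) ≤ x ⬝ᵥ (A *ᵥ x) := by
  set μ : ℝ := ⨅ i, hA.eigenvalues i
  have hB : (-algebraMap ℝ (Matrix ι ι ℝ) μ + A).IsHermitian := by
    refine IsHermitian.add ?_ hA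
    simp [IsHermitian, algebraMap_eq_diagonal]
  have hpsd : (-algebraMap ℝ (Matrix ι ι ℝ) μ + A).PosSemidef := by
    rw [hB.posSemidef_iff_eigenvalues_nonneg]
    intro i
    have hmem := spectrum.add_mem_iff.mpr (hB.eigenvalues_mem_spectrum_real i)
    rw [hA.spectrum_real_eq_range_eigenvalues] at hmem
    obtain ⟨j, hj⟩ := hmem
    have hle : μ ≤ hA.eigenvalues j := ciInf_le (Set.finite_range _).bddBelow j
    rw [hj] at hle
    simpa using hle
  have hx := hpsd.dotProduct_mulVec_nonneg x
  simp only [star_trivial, add_mulVec, neg_mulVec, Algebra.algebraMap_eq_smul_one, smul_mulVec,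
    one_mulVec, dotProduct_add, dotProduct_neg, dotProduct_smul, smul_eq_mul] at hx
  linarith

/-- A symmetric block matrix with off-diagonal blocks `-1` and scalar lower right block `d • 1` is
positive definite as soon as the quadratic form of the upper left block is at least `m * ‖x‖ ^ 2`
for some `m` with `1 < d * m`. -/
theorem posDef_fromBlocks_neg_one_smul_one (hA : A.IsHermitian) {d m : ℝ} (hd : 0 < d)
    (hdm : 1 < d * m) (hm : ∀ x : ι → ℝ, m * (x ⬝ᵥ x) ≤ x ⬝ᵥ (A *ᵥ x)) :
    (fromBlocks A (-1 : Matrix ι ι ℝ) (-1 : Matrix ι ι ℝ)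
      (d • (1 : Matrix ι ι ℝ))).PosDef := by
  refine .of_dotProduct_mulVec_pos (hA.fromBlocks (by simp) (by simp [IsHermitian])) fun z hz => ?_
  obtain ⟨u, v, rfl⟩ : ∃ u v, z = Sum.elim u v := ⟨_, _, (Sum.elim_comp_inl_inr z).symm⟩
  have hform : star (Sum.elim u v) ⬝ᵥ (fromBlocks A (-1 : Matrix ι ι ℝ) (-1 : Matrix ι ι ℝ)
      (d • (1 : Matrix ι ι ℝ)) *ᵥ Sum.elim u v) =
      u ⬝ᵥ (A *ᵥ u) - 2 * (u ⬝ᵥ v) + d * (v ⬝ᵥ v) := by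
    simp only [star_trivial, fromBlocks_mulVec, Sum.elim_comp_inl, Sum.elim_comp_inr,
      sumElim_dotProduct_sumElim, neg_mulVec, one_mulVec, smul_mulVec, dotProduct_add,
      dotProduct_neg, dotProduct_smul, smul_eq_mul, dotProduct_comm v u]
    ring
  rw [hform]
  by_cases hu : u = 0
  · have hv : v ≠ 0 := by
      rintro rfl
      exact hz (by simp [hu])
    have hvv : 0 < v ⬝ᵥ v := by simpa using dotProduct_star_self_pos_iff.mpr hv
    simpa [hu] using mul_pos hd hvv
  · have huu : 0 < u ⬝ᵥ u := by simpa using dotProduct_star_self_pos_iff.mpr hu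
    have hsq : 0 ≤ (u - d • v) ⬝ᵥ (u - d • v) := by
      simpa using dotProduct_star_self_nonneg (u - d • v)
    simp only [sub_dotProduct, dotProduct_sub, smul_dotProduct, dotProduct_smul, smul_eq_mul,
      dotProduct_comm v u] at hsq
    have hgap : 0 < (d * m - 1) * (u ⬝ᵥ u) := mul_pos (by linarith) huu
    have hlow := mul_le_mul_of_nonneg_left (hm u) hd.le
    refine pos_of_mul_pos_right (a := d) ?_ hd.le
    linarith

end Matrix

/-- Let `H ∈ ℝ^{n×n}` with `H + Hᵀ` positive definite, let
`λ̄ = λ_min(H + Hᵀ)`, `0 < γ < 1` and `k > 1 / (2γ(1−γ²)λ̄)`. Then the block matrix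
`Q₀ = [[k(1−γ²)(H + Hᵀ), −Iₙ], [−Iₙ, 2γ Iₙ]]` is symmetric positive definite. -/
theorem stmt6 (n : ℕ) (hn : 0 < n) (H : Matrix (Fin n) (Fin n) ℝ)
    (hH : (H + Hᵀ).PosDef) (γ k : ℝ) (hγ0 : 0 < γ) (hγ1 : γ < 1)
    (hk : k > 1 / (2 * γ * (1 - γ ^ 2) * (⨅ i, hH.1.eigenvalues i))) :
    (Matrix.fromBlocks ((k * (1 - γ ^ 2)) • (H + Hᵀ)) (-1 : Matrix (Fin n) (Fin n) ℝ)
      (-1 : Matrix (Fin n) (Fin n) ℝ) ((2 * γ) • (1 : Matrix (Fin n) (Fin n) ℝ))).IsSymm ∧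
    (Matrix.fromBlocks ((k * (1 - γ ^ 2)) • (H + Hᵀ)) (-1 : Matrix (Fin n) (Fin n) ℝ)
      (-1 : Matrix (Fin n) (Fin n) ℝ) ((2 * γ) • (1 : Matrix (Fin n) (Fin n) ℝ))).PosDef := by
  have : Nonempty (Fin n) := ⟨⟨0, hn⟩⟩
  set μ : ℝ := ⨅ i, hH.1.eigenvalues i with hμ
  have hμ0 : 0 < μ := by
    obtain ⟨i, hi⟩ := exists_eq_ciInf_of_finite (f := hH.1.eigenvalues)
    rw [hμ, ← hi]
    exact hH.eigenvalues_pos i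
  have hγ : 0 < 1 - γ ^ 2 := by nlinarith
  have hden : 0 < 2 * γ * (1 - γ ^ 2) * μ := by positivity
  have hk0 : 0 < k := (one_div_pos.mpr hden).trans hk
  have hkμ : 1 < 2 * γ * (k * (1 - γ ^ 2) * μ) := by
    have := (div_lt_iff₀ hden).mp hk
    linarith
  have hpos := posDef_fromBlocks_neg_one_smul_one (A := (k * (1 - γ ^ 2)) • (H + Hᵀ))
    (hH.smul (mul_pos hk0 hγ)).1 (by positivity : 0 < 2 * γ) hkμ fun x => by
      rw [smul_mulVec, dotProduct_smul, smul_eq_mul, mul_assoc]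
      exact mul_le_mul_of_nonneg_left (hH.1.iInf_eigenvalues_mul_dotProduct_le x)
        (mul_pos hk0 hγ).le
  exact ⟨isHermitian_iff_isSymm.mp hpos.1, hpos⟩
end

section
/- Let H, P̄ ∈ ℝ^{n×n} with P̄ symmetric and Hᵀ P̄ + P̄ H = I_n, let γ, k, α ∈ ℝ, and define the 2n×2n block matrices P = [[P̄, −γP̄], [−γP̄, P̄]] and F = α·[[−kH, I_n], [−γkH, 0]]. Then P F + Fᵀ P = −α·[[k(1−γ²) I_n, −P̄], [−P̄, 2γ P̄]]. -/
open Matrix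

/-- Let `H, Pbar ∈ ℝ^{n×n}` with `Pbar` symmetric and
`Hᵀ Pbar + Pbar H = Iₙ`, let `γ, k, α ∈ ℝ`, and define the block matrices
`P = [[Pbar, −γPbar], [−γPbar, Pbar]]` and `F = α·[[−kH, Iₙ], [−γkH, 0]]`.
Then `P F + Fᵀ P = −α·[[k(1−γ²) Iₙ, −Pbar], [−Pbar, 2γ Pbar]]`. -/
theorem stmt7 (n : ℕ) (H Pbar : Matrix (Fin n) (Fin n) ℝ)
    (hsym : Pbar.IsSymm) (hlyap : Hᵀ * Pbar + Pbar * H = 1) (γ k α : ℝ) :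
    (Matrix.fromBlocks Pbar (-γ • Pbar) (-γ • Pbar) Pbar) *
        (α • Matrix.fromBlocks (-k • H) (1 : Matrix (Fin n) (Fin n) ℝ)
          (-(γ * k) • H) (0 : Matrix (Fin n) (Fin n) ℝ)) +
      (α • Matrix.fromBlocks (-k • H) (1 : Matrix (Fin n) (Fin n) ℝ)
          (-(γ * k) • H) (0 : Matrix (Fin n) (Fin n) ℝ))ᵀ *
        (Matrix.fromBlocks Pbar (-γ • Pbar) (-γ • Pbar) Pbar) =
      -α • Matrix.fromBlocks ((k * (1 - γ ^ 2)) • (1 : Matrix (Fin n) (Fin n) ℝ))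
        (-Pbar) (-Pbar) ((2 * γ) • Pbar) := by
  simp only [fromBlocks_smul, fromBlocks_transpose, fromBlocks_multiply, fromBlocks_add,
    transpose_smul, transpose_one, transpose_zero, Matrix.smul_mul, Matrix.mul_smul, Matrix.mul_one,
    Matrix.one_mul, Matrix.mul_zero, Matrix.zero_mul, smul_zero, add_zero]
  rw [← hlyap]
  congr 1 <;> module
end

section
/- Let t₀ ∈ ℝ, c > 0, and let α : [t₀,∞) → ℝ be continuous with α(t) > 0 for all t, ∫_{t₀}^{∞} α(s) ds = ∞, and ∫_{t₀}^{∞} α(s)² ds < ∞. Then ∫_{t₀}^{t} α(s)²·exp(−c·∫_{s}^{t} α(u) du) ds → 0 as t → ∞. -/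
open Set Filter MeasureTheory intervalIntegral

/-- if `α` is continuous and positive on `[t₀,∞)`, with
`∫_{t₀}^t α → ∞` as `t → ∞` and `α²` integrable on `[t₀,∞)`, then for `c > 0`,
`∫_{t₀}^t (α s)² · exp(−c ∫_s^t α) ds → 0` as `t → ∞`. -/
theorem stmt10 (t₀ c : ℝ) (hc : 0 < c) (α : ℝ → ℝ)
    (hαc : ContinuousOn α (Ici t₀)) (hαpos : ∀ t ∈ Ici t₀, 0 < α t)
    (hdiv : Tendsto (fun t => ∫ s in t₀..t, α s) atTop atTop)
    (hint : IntegrableOn (fun s => (α s) ^ 2) (Ici t₀)) :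
    Tendsto
      (fun t => ∫ s in t₀..t, (α s) ^ 2 * Real.exp ((-c) * ∫ u in s..t, α u))
      atTop (nhds 0) := by
  have hii : ∀ a ∈ Ici t₀, ∀ b ∈ Ici t₀, IntervalIntegrable α volume a b := fun a ha b hb =>
    (hαc.mono fun x hx => (le_inf ha hb : t₀ ≤ a ⊓ b).trans hx.1).intervalIntegrable
  have ht₀ : t₀ ∈ Ici t₀ := self_mem_Ici
  have hnonneg : ∀ a ∈ Ici t₀, ∀ b, a ≤ b → 0 ≤ ∫ u in a..b, α u := fun a ha b hab =>
    integral_nonneg hab fun u hu => (hαpos u (le_trans ha hu.1)).le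
  have hsub : ∀ a ∈ Ici t₀, ∀ b ∈ Ici t₀,
      ∫ u in a..b, α u = (∫ u in t₀..b, α u) - ∫ u in t₀..a, α u := fun a ha b hb =>
    (integral_interval_sub_left (hii _ ht₀ _ hb) (hii _ ht₀ _ ha)).symm
  have hmono : MonotoneOn (fun s => ∫ u in t₀..s, α u) (Ici t₀) := fun a ha b hb hab => by
    have := hnonneg a ha b hab
    rw [hsub a ha b hb] at this
    exact sub_nonneg.1 this
  -- Extend the integrand by zero to the half-line and apply dominated convergence.
  have hlim : Tendsto (fun t => ∫ s in Ioi t₀, (Iic t).indicator (fun s => (α s) ^ 2 *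
      Real.exp ((-c) * ((∫ u in t₀..t, α u) - ∫ u in t₀..s, α u))) s) atTop
      (nhds (∫ _ in Ioi t₀, (0 : ℝ))) := by
    refine tendsto_integral_filter_of_dominated_convergence (fun s => (α s) ^ 2) ?_ ?_
      (hint.mono_set Ioi_subset_Ici_self) ?_
    · refine Eventually.of_forall fun t => AEStronglyMeasurable.indicator ?_ measurableSet_Iic
      have hA : AEMeasurable (fun s => ∫ u in t₀..s, α u) (volume.restrict (Ioi t₀)) :=
        aemeasurable_restrict_of_monotoneOn measurableSet_Ioi (hmono.mono Ioi_subset_Ici_self)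
      exact (hint.mono_set Ioi_subset_Ici_self).aestronglyMeasurable.mul
        (Real.measurable_exp.comp_aemeasurable
          ((hA.const_sub _).const_mul (-c))).aestronglyMeasurable
    · filter_upwards [eventually_ge_atTop t₀] with t ht
      filter_upwards [ae_restrict_mem measurableSet_Ioi] with s hs
      by_cases hst : s ∈ Iic t
      · rw [indicator_of_mem hst, Real.norm_of_nonneg (by positivity)]
        refine mul_le_of_le_one_right (sq_nonneg _) (Real.exp_le_one_iff.2 ?_)
        have := sub_nonneg.2 (hmono (Ioi_subset_Ici_self hs) ht hst)
        exact mul_nonpos_of_nonpos_of_nonneg (by linarith) this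
      · rw [indicator_of_notMem hst, norm_zero]
        positivity
    · refine Eventually.of_forall fun s => ?_
      have h : Tendsto (fun t => (α s) ^ 2 *
          Real.exp ((-c) * ((∫ u in t₀..t, α u) - ∫ u in t₀..s, α u))) atTop (nhds 0) := by
        rw [← mul_zero ((α s) ^ 2)]
        exact (Real.tendsto_exp_atBot.comp
          ((tendsto_atTop_add_const_right _ _ hdiv).const_mul_atTop_of_neg
            (neg_lt_zero.2 hc))).const_mul _
      refine h.congr' ?_
      filter_upwards [eventually_ge_atTop s] with t ht
      rw [indicator_of_mem (mem_Iic.2 ht)]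
  rw [MeasureTheory.integral_zero] at hlim
  refine hlim.congr' ?_
  filter_upwards [eventually_ge_atTop t₀] with t ht
  rw [setIntegral_indicator measurableSet_Iic, Ioi_inter_Iic]
  refine (setIntegral_congr_fun measurableSet_Ioc fun s hs => ?_).trans (integral_of_le ht).symm
  simp only [hsub s hs.1.le t ht]
end

section
/- Let H ∈ ℝ^{n×n} be positive stable, let P̄ be a symmetric positive definite matrix with Hᵀ P̄ + P̄ H = I_n, let 0 < γ < 1, and let k > λ_max(P̄) / (2γ(1−γ²)). Then the 2n×2n block matrix F₀ = [[−kH, I_n], [−γkH, 0]] is Hurwitz, i.e., every eigenvalue of F₀ over ℂ has strictly negative real part. -/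
open Matrix

/-- A spectral value of a complex square matrix has an eigenvector. -/
lemma exists_mulVec_eq_smul_of_mem_spectrum {ι : Type*} [Fintype ι] [DecidableEq ι]
    {M : Matrix ι ι ℂ} {μ : ℂ} (hμ : μ ∈ spectrum ℂ M) :
    ∃ x : ι → ℂ, x ≠ 0 ∧ M *ᵥ x = μ • x := by
  rw [← Matrix.spectrum_toLin', ← Module.End.hasEigenvalue_iff_mem_spectrum] at hμ
  obtain ⟨x, hx⟩ := hμ.exists_hasEigenvector
  exact ⟨x, hx.2, by simpa using hx.apply_eq_smul⟩

/-- The Rayleigh bound for a real symmetric matrix. -/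
lemma Matrix.IsHermitian.dotProduct_mulVec_le_iSup_eigenvalues {ι : Type*} [Fintype ι]
    [DecidableEq ι] {P : Matrix ι ι ℝ} (hP : P.IsHermitian) (u : ι → ℝ) :
    u ⬝ᵥ P *ᵥ u ≤ (⨆ i, hP.eigenvalues i) * (u ⬝ᵥ u) := by
  set L := ⨆ i, hP.eigenvalues i
  set U : Matrix ι ι ℝ := ↑hP.eigenvectorUnitary
  have hU : U * Uᴴ = 1 := Unitary.coe_mul_star_self hP.eigenvectorUnitary
  have hspec : P = U * diagonal hP.eigenvalues * Uᴴ := by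
    simpa [Unitary.conjStarAlgAut_apply, star_eq_conjTranspose] using hP.spectral_theorem
  have hdiag : (diagonal fun i => L - hP.eigenvalues i).PosSemidef :=
    PosSemidef.diagonal fun i =>
      sub_nonneg.2 (le_ciSup (Set.finite_range hP.eigenvalues).bddAbove i)
  have hsub : L • (1 : Matrix ι ι ℝ) - P = U * (diagonal fun i => L - hP.eigenvalues i) * Uᴴ := by
    have : (diagonal fun i => L - hP.eigenvalues i) =
        L • (1 : Matrix ι ι ℝ) - diagonal hP.eigenvalues := by
      rw [smul_one_eq_diagonal, diagonal_sub]
    rw [this, mul_sub, sub_mul, ← hspec, mul_smul_comm, smul_mul_assoc, mul_one, hU]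
  have h := (hdiag.mul_mul_conjTranspose_same U).dotProduct_mulVec_nonneg u
  rw [← hsub] at h
  simp only [star_trivial, sub_mulVec, smul_mulVec, one_mulVec, dotProduct_sub,
    dotProduct_smul, smul_eq_mul] at h
  linarith

/-- If `HᵀP + PH = 1` with `P` symmetric, every eigenvalue `z` of `H` satisfies
`1 ≤ 2 (Re z) λ_max(P)`, provided `Re z ≥ 0`. -/
lemma one_le_two_mul_re_mul_iSup_eigenvalues {ι : Type*} [Fintype ι] [DecidableEq ι]
    {H P : Matrix ι ι ℝ} (hP : P.IsHermitian) (hlyap : Hᵀ * P + P * H = 1)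
    {z : ℂ} (hz : 0 ≤ z.re) {x : ι → ℂ} (hx : x ≠ 0)
    (hHx : H.map (algebraMap ℝ ℂ) *ᵥ x = z • x) :
    1 ≤ 2 * z.re * ⨆ i, hP.eigenvalues i := by
  set L := ⨆ i, hP.eigenvalues i
  set u : ι → ℝ := fun i => (x i).re
  set v : ι → ℝ := fun i => (x i).im
  have hu : H *ᵥ u = z.re • u - z.im • v := by
    ext i
    simpa [mulVec, dotProduct, u, v] using congrArg Complex.re (congrFun hHx i)
  have hv : H *ᵥ v = z.im • u + z.re • v := by
    ext i
    have := congrArg Complex.im (congrFun hHx i)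
    simp [mulVec, dotProduct] at this
    simp [mulVec, dotProduct, u, v, this]
    ring
  have hPt : Pᵀ = P := by simpa [IsHermitian, conjTranspose_eq_transpose_of_trivial] using hP
  have hsymm (a b : ι → ℝ) : a ⬝ᵥ P *ᵥ b = b ⬝ᵥ P *ᵥ a := by
    rw [dotProduct_mulVec, ← mulVec_transpose, hPt, dotProduct_comm]
  have hquad (w : ι → ℝ) : w ⬝ᵥ w = 2 * (w ⬝ᵥ P *ᵥ (H *ᵥ w)) := by
    have h := congrArg (fun M : Matrix ι ι ℝ => w ⬝ᵥ M *ᵥ w) hlyap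
    simp only [add_mulVec, dotProduct_add, one_mulVec, ← mulVec_mulVec] at h
    rw [dotProduct_mulVec w Hᵀ, vecMul_transpose, hsymm (H *ᵥ w) w] at h
    linarith
  have hqu := hquad u
  have hqv := hquad v
  rw [hu] at hqu
  rw [hv] at hqv
  simp only [mulVec_sub, mulVec_add, mulVec_smul, dotProduct_sub, dotProduct_add,
    dotProduct_smul, smul_eq_mul] at hqu hqv
  rw [hsymm v u] at hqv
  have hbu := hP.dotProduct_mulVec_le_iSup_eigenvalues u
  have hbv := hP.dotProduct_mulVec_le_iSup_eigenvalues v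
  have hpos : 0 < u ⬝ᵥ u + v ⬝ᵥ v := by
    have hu0 : 0 ≤ u ⬝ᵥ u := by simpa using dotProduct_star_self_nonneg u
    have hv0 : 0 ≤ v ⬝ᵥ v := by simpa using dotProduct_star_self_nonneg v
    refine lt_of_le_of_ne (add_nonneg hu0 hv0) fun h => hx ?_
    have hu' : u = 0 := dotProduct_self_eq_zero.1 (by linarith)
    have hv' : v = 0 := dotProduct_self_eq_zero.1 (by linarith)
    ext i
    exact Complex.ext (congrFun hu' i) (congrFun hv' i)
  have hmul := mul_le_mul_of_nonneg_left (add_le_add hbu hbv) hz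
  refine le_of_mul_le_mul_right ?_ hpos
  change _ ≤ 2 * z.re * L * _
  linarith

/-- If `μ² = -w (μ + γ)` with `Re μ ≥ 0` and `γ > 0`, then `Re w < γ`. -/
lemma re_lt_of_sq_eq_neg_mul_add {μ w : ℂ} {γ : ℝ} (hγ : 0 < γ) (hμ : 0 ≤ μ.re)
    (h : μ ^ 2 = -w * (μ + γ)) : w.re < γ := by
  have hre := congrArg Complex.re h
  have him := congrArg Complex.im h
  simp [pow_two] at hre him
  have hpos : 0 < (μ.re + γ) ^ 2 + μ.im ^ 2 := by positivity
  have key : w.re * ((μ.re + γ) ^ 2 + μ.im ^ 2) =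
      -((μ.re ^ 2 + μ.im ^ 2) * μ.re + γ * (μ.re ^ 2 - μ.im ^ 2)) := by
    linear_combination (μ.re + γ) * hre + μ.im * him
  have : 0 ≤ (μ.re ^ 2 + μ.im ^ 2) * μ.re := by positivity
  refine lt_of_mul_lt_mul_right ?_ hpos.le
  have : 0 < γ * (μ.re + γ) ^ 2 := by positivity
  have : 0 ≤ γ * μ.re ^ 2 := by positivity
  linarith

/-- An eigenvalue `μ ≠ -γ` of `[[-kH, 1], [-γkH, 0]]` with `k ≠ 0` arises from an eigenvalue `z`
of `H` with `μ² = -kz (μ + γ)`. -/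
lemma exists_eigenvector_of_mem_spectrum_fromBlocks {ι : Type*} [Fintype ι] [DecidableEq ι]
    {H : Matrix ι ι ℝ} {γ k : ℝ} {μ : ℂ} (hk : k ≠ 0) (hμγ : μ + γ ≠ 0)
    (hμ : μ ∈ spectrum ℂ ((fromBlocks (-k • H) (1 : Matrix ι ι ℝ)
      (-(γ * k) • H) (0 : Matrix ι ι ℝ)).map (algebraMap ℝ ℂ))) :
    ∃ (z : ℂ) (x : ι → ℂ), x ≠ 0 ∧ H.map (algebraMap ℝ ℂ) *ᵥ x = z • x ∧
      μ ^ 2 = -(k * z) * (μ + γ) := by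
  obtain ⟨y, hy, hMy⟩ := exists_mulVec_eq_smul_of_mem_spectrum hμ
  set G := H.map (algebraMap ℝ ℂ)
  have hblock : (fromBlocks (-k • H) (1 : Matrix ι ι ℝ)
      (-(γ * k) • H) (0 : Matrix ι ι ℝ)).map (algebraMap ℝ ℂ) =
      fromBlocks (-(k : ℂ) • G) 1 (-(γ * k : ℂ) • G) 0 := by
    rw [fromBlocks_map]
    congr 1
    · ext; simp [G]
    · simp
    · ext; simp [G]
  rw [hblock, fromBlocks_mulVec] at hMy
  have h₁ (i : ι) : -(k : ℂ) * (G *ᵥ (y ∘ Sum.inl)) i + y (Sum.inr i) = μ * y (Sum.inl i) := by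
    simpa [neg_mulVec, smul_mulVec] using congrFun hMy (Sum.inl i)
  have h₂ (i : ι) : -(γ * k : ℂ) * (G *ᵥ (y ∘ Sum.inl)) i = μ * y (Sum.inr i) := by
    simpa [neg_mulVec, smul_mulVec] using congrFun hMy (Sum.inr i)
  have hkC : (k : ℂ) ≠ 0 := by exact_mod_cast hk
  refine ⟨-μ ^ 2 / (k * (μ + γ)), y ∘ Sum.inl, fun h0 => hy ?_, ?_, by field_simp⟩
  · have hl (i : ι) : y (Sum.inl i) = 0 := congrFun h0 i
    ext (i | i)
    · exact hl i
    · simpa [h0, hl] using h₁ i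
  · ext i
    simp only [Pi.smul_apply, smul_eq_mul, Function.comp_apply]
    field_simp
    linear_combination -μ * h₁ i - h₂ i

/-- Let `H ∈ ℝ^{n×n}` be positive stable, `Pbar` symmetric positive
definite with `Hᵀ Pbar + Pbar H = Iₙ`, `0 < γ < 1`, and
`k > λ_max(Pbar) / (2γ(1−γ²))`. Then the block matrix
`F₀ = [[−kH, Iₙ], [−γkH, 0]]` is Hurwitz: every eigenvalue of `F₀` over `ℂ` has
strictly negative real part. -/
theorem stmt12 (n : ℕ) (hn : 0 < n) (H Pbar : Matrix (Fin n) (Fin n) ℝ)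
    (hstable : ∀ μ ∈ spectrum ℂ (H.map (algebraMap ℝ ℂ)), 0 < μ.re)
    (hP : Pbar.PosDef) (hPsym : Pbar.IsSymm)
    (hlyap : Hᵀ * Pbar + Pbar * H = 1)
    (γ k : ℝ) (hγ0 : 0 < γ) (hγ1 : γ < 1)
    (hk : k > (⨆ i, hP.1.eigenvalues i) / (2 * γ * (1 - γ ^ 2))) :
    ∀ μ ∈ spectrum ℂ
      ((Matrix.fromBlocks (-k • H) (1 : Matrix (Fin n) (Fin n) ℝ)
          (-(γ * k) • H) (0 : Matrix (Fin n) (Fin n) ℝ)).map (algebraMap ℝ ℂ)),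
      μ.re < 0 := by
  intro μ hμ
  by_contra! hre
  set L := ⨆ i, hP.1.eigenvalues i
  have hL : 0 < L :=
    (hP.eigenvalues_pos ⟨0, hn⟩).trans_le (le_ciSup (Set.finite_range hP.1.eigenvalues).bddAbove _)
  have hden : 0 < 2 * γ * (1 - γ ^ 2) := by
    have : 0 < 1 - γ ^ 2 := by nlinarith
    positivity
  have hk0 : 0 < k := (div_pos hL hden).trans hk
  have hμγ : μ + γ ≠ 0 := fun h => by
    have := congrArg Complex.re h
    simp at this
    linarith
  obtain ⟨z, x, hx, hHx, hz⟩ := exists_eigenvector_of_mem_spectrum_fromBlocks hk0.ne' hμγ hμ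
  have hzpos : 0 < z.re := by
    refine hstable z ?_
    rw [← Matrix.spectrum_toLin', ← Module.End.hasEigenvalue_iff_mem_spectrum]
    exact Module.End.hasEigenvalue_of_hasEigenvector
      (Module.End.hasEigenvector_iff.2 ⟨Module.End.mem_eigenspace_iff.2 (by simpa using hHx), hx⟩)
  have hLz : 1 ≤ 2 * z.re * L := one_le_two_mul_re_mul_iSup_eigenvalues hP.1 hlyap hzpos.le hx hHx
  have hkz : k * z.re < γ := by
    simpa using re_lt_of_sq_eq_neg_mul_add hγ0 hre hz
  have hkL : L < k * (2 * γ * (1 - γ ^ 2)) := (div_lt_iff₀ hden).1 hk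
  have h₁ : 1 < 2 * z.re * (k * (2 * γ * (1 - γ ^ 2))) :=
    hLz.trans_lt (mul_lt_mul_of_pos_left hkL (by positivity))
  have h₂ : k * z.re * (2 * γ * (1 - γ ^ 2)) < γ * (2 * γ * (1 - γ ^ 2)) :=
    mul_lt_mul_of_pos_right hkz hden
  nlinarith [sq_nonneg (2 * γ ^ 2 - 1)]
end

section
/- Let N ≥ 1 and let H₁,...,H_N ∈ ℝ^{n×n} be matrices such that H_p + H_pᵀ is positive definite for every p, set λ̄ = min_p λ_min(H_p + H_pᵀ) > 0, let 0 < γ < 1, and let k > 1 / (2γ(1−γ²)λ̄). Let α : [t₀,∞) → ℝ be continuous with α(t) > 0 and ∫_{t₀}^{∞} α(s) ds = ∞, let σ : [t₀,∞) → {1,...,N} be piecewise constant, and set F_p = [[−kH_p, I_n], [−γkH_p, 0]] ∈ ℝ^{2n×2n}. If ε : [t₀,∞) → ℝ^{2n} is continuous, piecewise differentiable, and satisfies ε′(t) = α(t)·F_{σ(t)}·ε(t) at every non-switching time t ≥ t₀, then ε(t) → 0 as t → ∞. -/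
open Matrix Set Filter

/-- Rayleigh bound: the quadratic form of a real symmetric matrix is bounded below by any lower
bound of its eigenvalues. -/
theorem Matrix.IsHermitian.mul_dotProduct_self_le {ι : Type*} [Fintype ι] [DecidableEq ι]
    {A : Matrix ι ι ℝ} (hA : A.IsHermitian) {c : ℝ} (hc : ∀ i, c ≤ hA.eigenvalues i)
    (x : ι → ℝ) : c * (x ⬝ᵥ x) ≤ x ⬝ᵥ A *ᵥ x := by
  have hpsd : (A - algebraMap ℝ (Matrix ι ι ℝ) c).PosSemidef := by
    rw [posSemidef_iff_isHermitian_and_spectrum_nonneg]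
    refine ⟨hA.sub ?_, ?_⟩
    · simp [IsHermitian, algebraMap_eq_diagonal]
    · intro μ hμ
      rw [← spectrum.sub_singleton_eq, hA.spectrum_real_eq_range_eigenvalues] at hμ
      obtain ⟨_, ⟨i, rfl⟩, _, rfl, rfl⟩ := hμ
      exact sub_nonneg.2 (hc i)
  have h := hpsd.dotProduct_mulVec_nonneg x
  simp only [star_trivial, sub_mulVec, dotProduct_sub, Algebra.algebraMap_eq_smul_one,
    smul_mulVec, one_mulVec, dotProduct_smul, smul_eq_mul] at h
  linarith

theorem HasDerivAt.dotProduct {ι : Type*} [Fintype ι] {f g : ℝ → ι → ℝ} {f' g' : ι → ℝ} {t : ℝ}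
    (hf : HasDerivAt f f' t) (hg : HasDerivAt g g' t) :
    HasDerivAt (fun s => f s ⬝ᵥ g s) (f' ⬝ᵥ g t + f t ⬝ᵥ g') t := by
  simp only [_root_.dotProduct, ← Finset.sum_add_distrib]
  exact HasDerivAt.fun_sum fun i _ => (hasDerivAt_pi.1 hf i).mul (hasDerivAt_pi.1 hg i)

/-- A continuous function whose derivative is nonpositive away from the points of a sequence
increasing to infinity stays below its initial value. -/
theorem le_initial_of_hasDerivAt_nonpos {f f' : ℝ → ℝ} {τ : ℕ → ℝ} (hτ : StrictMono τ)
    (hτtop : Tendsto τ atTop atTop) (hf : ContinuousOn f (Ici (τ 0)))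
    (hf' : ∀ s ∈ Ici (τ 0), (∀ j, s ≠ τ j) → HasDerivAt f (f' s) s)
    (hnonpos : ∀ s ∈ Ici (τ 0), f' s ≤ 0) {t : ℝ} (ht : τ 0 ≤ t) : f t ≤ f (τ 0) := by
  have hpiece : ∀ j, AntitoneOn f (Icc (τ j) (τ (j + 1))) := by
    intro j
    have h0 : τ 0 ≤ τ j := hτ.monotone j.zero_le
    refine antitoneOn_of_hasDerivWithinAt_nonpos (f' := f') (convex_Icc _ _)
      (hf.mono fun s hs => h0.trans hs.1) ?_ ?_
    · intro s hs
      rw [interior_Icc] at hs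
      refine (hf' s (h0.trans hs.1.le) fun i hi => ?_).hasDerivWithinAt
      subst hi
      have h1 := hτ.lt_iff_lt.1 hs.1
      have h2 := hτ.lt_iff_lt.1 hs.2
      omega
    · intro s hs
      rw [interior_Icc] at hs
      exact hnonpos s (h0.trans hs.1.le)
  have hle : ∀ j, ∀ s ∈ Icc (τ 0) (τ j), f s ≤ f (τ 0) := by
    intro j
    induction j with
    | zero =>
      rintro s ⟨h1, h2⟩
      rw [le_antisymm h2 h1]
    | succ j ih =>
      rintro s ⟨h1, h2⟩
      rcases le_total s (τ j) with h | h
      · exact ih s ⟨h1, h⟩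
      · exact (hpiece j ⟨le_rfl, h.trans h2⟩ ⟨h, h2⟩ h).trans
          (ih _ ⟨hτ.monotone j.zero_le, le_rfl⟩)
  obtain ⟨j, hj⟩ := (hτtop.eventually_ge_atTop t).exists
  exact hle j t ⟨ht, hj⟩

/-- Grönwall decay: if `V ≥ 0` satisfies `V' ≤ -c α V` away from the points of a sequence
increasing to infinity and `∫ α = ∞`, then `V` tends to zero. -/
theorem tendsto_zero_of_hasDerivAt_le_neg_mul {V V' α : ℝ → ℝ} {τ : ℕ → ℝ} {c : ℝ} (hc : 0 < c)
    (hτ : StrictMono τ) (hτtop : Tendsto τ atTop atTop) (hα : ContinuousOn α (Ici (τ 0)))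
    (hdiv : Tendsto (fun t => ∫ s in (τ 0)..t, α s) atTop atTop)
    (hV : ContinuousOn V (Ici (τ 0))) (hV0 : ∀ s, 0 ≤ V s)
    (hV' : ∀ s ∈ Ici (τ 0), (∀ j, s ≠ τ j) → HasDerivAt V (V' s) s)
    (hle : ∀ s ∈ Ici (τ 0), V' s ≤ -c * α s * V s) : Tendsto V atTop (nhds 0) := by
  set A : ℝ → ℝ := fun t => ∫ s in (τ 0)..t, α s with hA
  have hint : ∀ t ∈ Ici (τ 0), MeasureTheory.IntegrableOn α (uIcc (τ 0) t) := fun t ht => by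
    rw [uIcc_of_le ht]
    exact (hα.mono Icc_subset_Ici_self).integrableOn_Icc
  have hAc : ContinuousOn A (Ici (τ 0)) := by
    intro t ht
    have h1 : t ≤ t + 1 := by linarith
    have h := intervalIntegral.continuousOn_primitive_interval (hint (t + 1) (le_trans ht h1))
    rw [uIcc_of_le (le_trans ht h1)] at h
    refine (h t ⟨ht, h1⟩).mono_of_mem_nhdsWithin ?_
    rw [← Ici_inter_Iic]
    exact inter_mem_nhdsWithin _ (Iic_mem_nhds (by linarith))
  have hAd : ∀ t ∈ Ioi (τ 0), HasDerivAt A (α t) t := fun t ht =>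
    intervalIntegral.integral_hasDerivAt_right (hint t (Ioi_subset_Ici_self ht)).intervalIntegrable
      ((hα.mono Ioi_subset_Ici_self).stronglyMeasurableAtFilter isOpen_Ioi t ht)
      (hα.continuousAt (Ici_mem_nhds ht))
  have hW : ∀ t ∈ Ici (τ 0), V t * Real.exp (c * A t) ≤ V (τ 0) := by
    intro t ht
    have h := le_initial_of_hasDerivAt_nonpos (f := fun s => V s * Real.exp (c * A s))
      (f' := fun s => V' s * Real.exp (c * A s) + V s * (Real.exp (c * A s) * (c * α s)))
      hτ hτtop (hV.mul (hAc.const_mul c).rexp) ?_ ?_ ht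
    · simpa [hA] using h
    · intro s hs hne
      exact (hV' s hs hne).mul ((hAd s (lt_of_le_of_ne hs (hne 0).symm)).const_mul c).exp
    · intro s hs
      nlinarith [mul_le_mul_of_nonneg_right (hle s hs) (Real.exp_pos (c * A s)).le]
  have hlim : Tendsto (fun t => V (τ 0) * Real.exp (-(c * A t))) atTop (nhds 0) := by
    simpa using ((Real.tendsto_exp_neg_atTop_nhds_zero.comp
      (hdiv.const_mul_atTop hc)).const_mul (V (τ 0)))
  refine squeeze_zero' (Eventually.of_forall hV0) ?_ hlim
  filter_upwards [eventually_ge_atTop (τ 0)] with t ht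
  rw [Real.exp_neg, ← div_eq_mul_inv, le_div_iff₀ (Real.exp_pos _)]
  exact hW t ht

/-- The Lyapunov function `|x|² - 2γ⟨x, v⟩ + |v|²` on `ℝ²ⁿ ∋ (x, v)`. -/
def lyapunov {ι : Type*} [Fintype ι] (γ : ℝ) (x v : ι → ℝ) : ℝ :=
  x ⬝ᵥ x - 2 * γ * (x ⬝ᵥ v) + v ⬝ᵥ v

theorem two_mul_abs_dotProduct_le {ι : Type*} [Fintype ι] (x v : ι → ℝ) :
    2 * |x ⬝ᵥ v| ≤ x ⬝ᵥ x + v ⬝ᵥ v := by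
  have hadd : 0 ≤ (x + v) ⬝ᵥ (x + v) := Finset.sum_nonneg fun i _ => mul_self_nonneg _
  have hsub : 0 ≤ (x - v) ⬝ᵥ (x - v) := Finset.sum_nonneg fun i _ => mul_self_nonneg _
  simp only [add_dotProduct, dotProduct_add, sub_dotProduct, dotProduct_sub,
    dotProduct_comm v x] at hadd hsub
  rcases abs_cases (x ⬝ᵥ v) with h | h <;> linarith

theorem mul_le_lyapunov {ι : Type*} [Fintype ι] {γ : ℝ} (hγ : 0 ≤ γ) (x v : ι → ℝ) :
    (1 - γ) * (x ⬝ᵥ x + v ⬝ᵥ v) ≤ lyapunov γ x v := by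
  have h := two_mul_abs_dotProduct_le x v
  unfold lyapunov
  nlinarith [mul_le_mul_of_nonneg_left (le_abs_self (x ⬝ᵥ v)) hγ]

theorem lyapunov_le_mul {ι : Type*} [Fintype ι] {γ : ℝ} (hγ : 0 ≤ γ) (x v : ι → ℝ) :
    lyapunov γ x v ≤ (1 + γ) * (x ⬝ᵥ x + v ⬝ᵥ v) := by
  have h := two_mul_abs_dotProduct_le x v
  unfold lyapunov
  nlinarith [mul_le_mul_of_nonneg_left (neg_abs_le (x ⬝ᵥ v)) hγ]

/-- If `1 < 4ab`, the form `a|x|² - ⟨x, v⟩ + b|v|²` is uniformly positive definite. -/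
theorem exists_pos_mul_le_quadratic {ι : Type*} [Fintype ι] {a b : ℝ} (ha : 0 < a) (hb : 0 < b)
    (hab : 1 < 4 * a * b) : ∃ c > 0, ∀ x v : ι → ℝ,
      c * (x ⬝ᵥ x + v ⬝ᵥ v) ≤ a * (x ⬝ᵥ x) - x ⬝ᵥ v + b * (v ⬝ᵥ v) := by
  have hd : 0 < 4 * a * b - 1 := by linarith
  refine ⟨(4 * a * b - 1) / (4 * (a + b)), by positivity, fun x v => ?_⟩
  set c := (4 * a * b - 1) / (4 * (a + b)) with hc
  have hcab : c * (4 * (a + b)) = 4 * a * b - 1 := by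
    rw [hc]; field_simp
  have hcpos : 0 < c := by positivity
  have hca : 0 < a - c := by nlinarith [sq_nonneg a]
  have hsq : 0 ≤ ((2 * (a - c)) • x - v) ⬝ᵥ ((2 * (a - c)) • x - v) :=
    Finset.sum_nonneg fun i _ => mul_self_nonneg _
  have hv : 0 ≤ v ⬝ᵥ v := Finset.sum_nonneg fun i _ => mul_self_nonneg _
  simp only [sub_dotProduct, dotProduct_sub, smul_dotProduct, dotProduct_smul, smul_eq_mul,
    dotProduct_comm v x] at hsq
  have hdet : 1 ≤ 4 * (a - c) * (b - c) := by nlinarith [sq_nonneg c]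
  have hmul := mul_le_mul_of_nonneg_right hdet hv
  refine le_of_mul_le_mul_left (a := 4 * (a - c)) ?_ (by linarith)
  nlinarith

theorem dotProduct_add_transpose_mulVec {ι : Type*} [Fintype ι] (A : Matrix ι ι ℝ) (x : ι → ℝ) :
    x ⬝ᵥ (A + Aᵀ) *ᵥ x = 2 * (x ⬝ᵥ A *ᵥ x) := by
  rw [add_mulVec, dotProduct_add, mulVec_transpose, dotProduct_comm x (x ᵥ* A),
    ← dotProduct_mulVec]
  ring

/-- The derivative of the Lyapunov function along `x' = a (-k A x + v)`, `v' = -a γ k A x`. -/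
theorem HasDerivAt.lyapunov {ι : Type*} [Fintype ι] {x v : ℝ → ι → ℝ} {A : Matrix ι ι ℝ}
    {a k γ t : ℝ} (hx : HasDerivAt x (a • (-(k • A *ᵥ x t) + v t)) t)
    (hv : HasDerivAt v (a • -((γ * k) • A *ᵥ x t)) t) :
    HasDerivAt (fun s => _root_.lyapunov γ (x s) (v s))
      (-2 * a * (k * (1 - γ ^ 2) * (x t ⬝ᵥ A *ᵥ x t) - x t ⬝ᵥ v t + γ * (v t ⬝ᵥ v t))) t := by
  refine (((hx.dotProduct hx).sub ((hx.dotProduct hv).const_mul (2 * γ))).add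
    (hv.dotProduct hv)).congr_deriv ?_
  simp only [smul_dotProduct, dotProduct_smul, add_dotProduct, dotProduct_add, neg_dotProduct,
    dotProduct_neg, smul_eq_mul, dotProduct_comm (A *ᵥ x t), dotProduct_comm (v t) (x t)]
  ring

/-- switched/time-varying topology: Let `H₁,...,H_N ∈ ℝ^{n×n}` with
each `H_p + H_pᵀ` positive definite, `λ̄ = min_p λ_min(H_p + H_pᵀ)`, `0 < γ < 1` and
`k > 1/(2γ(1−γ²)λ̄)`. Let `α` be continuous and positive on `[t₀,∞)` with
`∫_{t₀}^t α → ∞`, let `σ` be piecewise constant on contiguous intervals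
`[tj j, tj (j+1))` with `tj 0 = t₀`, `tj` strictly increasing and `tj j → ∞`, and set
`F_p = [[−kH_p, Iₙ], [−γkH_p, 0]]`. If `ε : [t₀,∞) → ℝ^{2n}` is continuous and
satisfies `ε′(t) = α(t)·F_{σ(t)}·ε(t)` at every non-switching time `t ≥ t₀`, then
`ε(t) → 0` as `t → ∞`. -/
theorem stmt14 (n N : ℕ) (hn : 0 < n) (hN : 0 < N) (t₀ : ℝ)
    (H : Fin N → Matrix (Fin n) (Fin n) ℝ)
    (hH : ∀ p, (H p + (H p)ᵀ).PosDef)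
    (γ k : ℝ) (hγ0 : 0 < γ) (hγ1 : γ < 1)
    (hk : k > 1 / (2 * γ * (1 - γ ^ 2) * (⨅ p, ⨅ i, (hH p).1.eigenvalues i)))
    (α : ℝ → ℝ) (hαc : ContinuousOn α (Ici t₀)) (hαpos : ∀ t ∈ Ici t₀, 0 < α t)
    (hdiv : Tendsto (fun t => ∫ s in t₀..t, α s) atTop atTop)
    (σ : ℝ → Fin N) (tj : ℕ → ℝ) (htj0 : tj 0 = t₀) (htjmono : StrictMono tj)
    (htjtop : Tendsto tj atTop atTop)
    (hσ : ∀ j : ℕ, ∀ s ∈ Ico (tj j) (tj (j + 1)), σ s = σ (tj j))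
    (ε : ℝ → (Fin n ⊕ Fin n → ℝ)) (hεc : ContinuousOn ε (Ici t₀))
    (hε : ∀ s ∈ Ici t₀, (∀ j : ℕ, s ≠ tj j) →
      HasDerivAt ε
        (α s • (Matrix.fromBlocks (-k • H (σ s)) (1 : Matrix (Fin n) (Fin n) ℝ)
            (-(γ * k) • H (σ s)) (0 : Matrix (Fin n) (Fin n) ℝ)).mulVec (ε s))
        s) :
    Tendsto ε atTop (nhds 0) := by
  have : Nonempty (Fin N) := ⟨⟨0, hN⟩⟩
  have : Nonempty (Fin n) := ⟨⟨0, hn⟩⟩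
  subst htj0
  set l : ℝ := ⨅ p, ⨅ i, (hH p).1.eigenvalues i with hl
  have hlpos : 0 < l := by
    obtain ⟨p, hp⟩ := exists_eq_ciInf_of_finite (f := fun p => ⨅ i, (hH p).1.eigenvalues i)
    obtain ⟨i, hi⟩ := exists_eq_ciInf_of_finite (f := (hH p).1.eigenvalues)
    rw [hl, ← hp, ← hi]
    exact (hH p).eigenvalues_pos i
  have hlle : ∀ p i, l ≤ (hH p).1.eigenvalues i := fun p i =>
    (ciInf_le (Set.finite_range _).bddBelow p).trans (ciInf_le (Set.finite_range _).bddBelow i)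
  have hform : ∀ p (x : Fin n → ℝ), l / 2 * (x ⬝ᵥ x) ≤ x ⬝ᵥ H p *ᵥ x := fun p x => by
    have h := (hH p).1.mul_dotProduct_self_le (hlle p) x
    rw [dotProduct_add_transpose_mulVec] at h
    linarith
  have hγ2 : 0 < 1 - γ ^ 2 := by nlinarith
  have hkpos : 0 < k := lt_trans (by positivity) hk
  have hgain : 1 < 4 * (k * (1 - γ ^ 2) * (l / 2)) * γ := by
    rw [gt_iff_lt, div_lt_iff₀ (by positivity)] at hk
    linarith
  obtain ⟨c, hc, hquad⟩ := exists_pos_mul_le_quadratic (ι := Fin n)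
    (show 0 < k * (1 - γ ^ 2) * (l / 2) by positivity) hγ0 hgain
  set x : ℝ → Fin n → ℝ := fun t i => ε t (Sum.inl i)
  set v : ℝ → Fin n → ℝ := fun t i => ε t (Sum.inr i)
  have hx : ∀ s ∈ Ici (tj 0), (∀ j, s ≠ tj j) →
      HasDerivAt x (α s • (-(k • H (σ s) *ᵥ x s) + v s)) s := fun s hs hne => by
    have h := hasDerivAt_pi.1 (hε s hs hne)
    refine hasDerivAt_pi.2 fun i => (h (Sum.inl i)).congr_deriv ?_
    simp [fromBlocks_mulVec, neg_mulVec, smul_mulVec, x, v, Function.comp_def]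
  have hv : ∀ s ∈ Ici (tj 0), (∀ j, s ≠ tj j) →
      HasDerivAt v (α s • -((γ * k) • H (σ s) *ᵥ x s)) s := fun s hs hne => by
    have h := hasDerivAt_pi.1 (hε s hs hne)
    refine hasDerivAt_pi.2 fun i => (h (Sum.inr i)).congr_deriv ?_
    simp [fromBlocks_mulVec, neg_mulVec, smul_mulVec, x, Function.comp_def]
  have hnn : ∀ y : Fin n → ℝ, 0 ≤ y ⬝ᵥ y := fun y =>
    Finset.sum_nonneg fun i _ => mul_self_nonneg _
  have hγ' : 0 < 1 - γ := sub_pos.2 hγ1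
  have hVc : ContinuousOn (fun s => lyapunov γ (x s) (v s)) (Ici (tj 0)) := by
    have hcoord := continuousOn_pi.1 hεc
    unfold lyapunov dotProduct
    fun_prop
  have hV : Tendsto (fun s => lyapunov γ (x s) (v s)) atTop (nhds 0) := by
    refine tendsto_zero_of_hasDerivAt_le_neg_mul (c := 2 * c / (1 + γ)) (by positivity) htjmono
      htjtop hαc hdiv hVc (fun s => ?_) (fun s hs hne => (hx s hs hne).lyapunov (hv s hs hne))
      fun s hs => ?_
    · exact (mul_nonneg hγ'.le (add_nonneg (hnn _) (hnn _))).trans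
        (mul_le_lyapunov hγ0.le (x s) (v s))
    · have hα := hαpos s hs
      have hHs := mul_le_mul_of_nonneg_left (hform (σ s) (x s)) (mul_pos hkpos hγ2).le
      have hq := hquad (x s) (v s)
      have hup : lyapunov γ (x s) (v s) / (1 + γ) ≤ x s ⬝ᵥ x s + v s ⬝ᵥ v s := by
        rw [div_le_iff₀ (by positivity), mul_comm]
        exact lyapunov_le_mul hγ0.le (x s) (v s)
      have hlow := mul_le_mul_of_nonneg_left hup hc.le
      calc _ ≤ -2 * α s * (c * (lyapunov γ (x s) (v s) / (1 + γ))) :=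
            mul_le_mul_of_nonpos_left (by linarith) (by linarith)
        _ = _ := by ring
  have hsum : Tendsto (fun s => x s ⬝ᵥ x s + v s ⬝ᵥ v s) atTop (nhds 0) := by
    refine squeeze_zero (fun s => add_nonneg (hnn _) (hnn _)) (fun s => ?_)
      (by simpa using hV.div_const (1 - γ))
    rw [le_div_iff₀ hγ', mul_comm]
    exact mul_le_lyapunov hγ0.le (x s) (v s)
  refine tendsto_pi_nhds.2 fun i => ?_
  have hsq : Tendsto (fun s => ε s i ^ 2) atTop (nhds 0) := by
    refine squeeze_zero (fun s => sq_nonneg _) (fun s => ?_) hsum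
    have hterm : ∀ (y : Fin n → ℝ) j, y j ^ 2 ≤ y ⬝ᵥ y := fun y j => by
      rw [sq]
      exact Finset.single_le_sum (f := fun j => y j * y j) (fun i _ => mul_self_nonneg _)
        (Finset.mem_univ j)
    rcases i with i | i
    · exact (hterm (x s) i).trans (le_add_of_nonneg_right (hnn _))
    · exact (hterm (v s) i).trans (le_add_of_nonneg_left (hnn _))
  rw [Pi.zero_apply, tendsto_zero_iff_abs_tendsto_zero]
  simpa [Function.comp_def, Real.sqrt_sq_eq_abs] using hsq.sqrt
end
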